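/- Let $k$ be a field and $n \ge 3$. For each $[s, t] \in \mathbb{P}^1$ with $(s,t) \ne (0,0)$, the ideal $I_{s,t} = (x_0^2, x_0 x_1, x_1^2, t x_0 x_3 - s x_1 x_2) \subset k[x_0, \ldots, x_n]$ has Hilbert polynomial $P_n(m) = 2\binom{n-2+m}{m} - \binom{n-4+m}{m}$: that is, for all sufficiently large $m$, $\dim_k (k[x_0,\ldots,x_n]/I_{s,t})_m = P_n(m)$. -/

import Mathlib

open MvPolynomial

theorem finrank_homogeneousSubmodule_fin (k : Type*) [Field k] (N m : ℕ) :
    Module.finrank k (homogeneousSubmodule (Fin N) k m) = N.multichoose m := by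
  rw [homogeneousSubmodule_eq_finsupp_supported,
    (AddMonoidAlgebra.supportedEquivFinsupp {d : Fin N →₀ ℕ | d.degree = m}).finrank_eq,
    Module.finrank_eq_nat_card_basis (Finsupp.basisSingleOne (R := k))]
  have e : {d : Fin N →₀ ℕ | d.degree = m} ≃ Sym (Fin N) m := (Sym.equivNatSum (Fin N) m).symm
  rw [Nat.card_congr e, Nat.card_eq_fintype_card, Sym.card_sym_eq_multichoose, Fintype.card_fin]

theorem multichoose_second_difference (N p : ℕ) :
    (N + 2).multichoose (p + 2) + 2 * (N + 2).multichoose (p + 1) =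
      (2 * (N + 2).multichoose (p + 2) - N.multichoose (p + 2)) + (N + 2).multichoose p := by
  have h₁ := Nat.multichoose_succ_succ (N + 1) (p + 1)
  have h₂ := Nat.multichoose_succ_succ N (p + 1)
  have h₃ := Nat.multichoose_succ_succ (N + 1) p
  simp only [add_assoc, Nat.reduceAdd] at h₁ h₂ h₃
  omega

section

variable {k : Type*} [Field k] {N : ℕ}

/-- The inclusion of `k[x₂, …]` into `k[x₀, x₁, x₂, …]`. -/
noncomputable def shiftTwo (k : Type*) [Field k] (N : ℕ) :
    MvPolynomial (Fin (N + 2)) k →ₐ[k] MvPolynomial (Fin (N + 4)) k :=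
  rename fun i => i.succ.succ

/-- The ideal `(x₀², x₀x₁, x₁², t·x₀x₃ - s·x₁x₂)`. -/
noncomputable def pencilIdeal (N : ℕ) (s t : k) : Ideal (MvPolynomial (Fin (N + 4)) k) :=
  Ideal.span {X 0 ^ 2, X 0 * X 1, X 1 ^ 2, C t * (X 0 * X 3) - C s * (X 1 * X 2)}

/-- Reduction modulo `(x₀, x₁)²`: the coefficients of `1`, `x₀` and `x₁`. -/
noncomputable def firstOrder (k : Type*) [Field k] (N : ℕ) :
    MvPolynomial (Fin (N + 4)) k →ₐ[k]
      TrivSqZeroExt (MvPolynomial (Fin (N + 2)) k)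
        (MvPolynomial (Fin (N + 2)) k × MvPolynomial (Fin (N + 2)) k) :=
  aeval (Fin.cons (TrivSqZeroExt.inr (1, 0)) (Fin.cons (TrivSqZeroExt.inr (0, 1))
    fun i => TrivSqZeroExt.inl (X i)))

theorem firstOrder_X_zero : firstOrder k N (X 0) = TrivSqZeroExt.inr (1, 0) := by
  simp [firstOrder]

theorem firstOrder_X_one : firstOrder k N (X 1) = TrivSqZeroExt.inr (0, 1) := by
  rw [firstOrder, aeval_X]; rfl

theorem firstOrder_X_succ_succ (i : Fin (N + 2)) :
    firstOrder k N (X i.succ.succ) = TrivSqZeroExt.inl (X i) := by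
  simp [firstOrder]

theorem firstOrder_shiftTwo (f : MvPolynomial (Fin (N + 2)) k) :
    firstOrder k N (shiftTwo k N f) = TrivSqZeroExt.inl f := by
  have : (firstOrder k N).comp (shiftTwo k N) = TrivSqZeroExt.inlAlgHom k _ _ := by
    ext i <;> simp [shiftTwo, firstOrder_X_succ_succ]
  exact DFunLike.congr_fun this f

theorem firstOrder_mem_of_mem_pencilIdeal {s t : k} {f : MvPolynomial (Fin (N + 4)) k}
    (hf : f ∈ pencilIdeal N s t) :
    ∃ d, firstOrder k N f = TrivSqZeroExt.inr (d * (C t * X 1), -(d * (C s * X 0))) := by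
  have h2 : firstOrder k N (X 2) = TrivSqZeroExt.inl (X 0) := firstOrder_X_succ_succ 0
  have h3 : firstOrder k N (X 3) = TrivSqZeroExt.inl (X 1) := firstOrder_X_succ_succ 1
  have hC (c : k) : firstOrder k N (C c) = TrivSqZeroExt.inl (C c) := (firstOrder k N).commutes c
  induction hf using Submodule.span_induction with
  | mem f hf =>
    rcases hf with rfl | rfl | rfl | rfl
    · exact ⟨0, by ext <;> simp [firstOrder_X_zero, pow_two]⟩
    · exact ⟨0, by ext <;> simp [firstOrder_X_zero, firstOrder_X_one]⟩
    · exact ⟨0, by ext <;> simp [firstOrder_X_one, pow_two]⟩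
    · refine ⟨1, ?_⟩
      simp only [map_sub, map_mul, firstOrder_X_zero, firstOrder_X_one, h2, h3, hC]
      ext <;> simp
  | zero => exact ⟨0, by ext <;> simp⟩
  | add f g _ _ hf hg =>
    obtain ⟨d, hd⟩ := hf
    obtain ⟨e, he⟩ := hg
    refine ⟨d + e, ?_⟩
    rw [map_add, hd, he, ← TrivSqZeroExt.inr_add, Prod.mk_add_mk]
    congr 2 <;> ring
  | smul a f _ hf =>
    obtain ⟨d, hd⟩ := hf
    refine ⟨(firstOrder k N a).fst * d, ?_⟩
    rw [smul_eq_mul, map_mul, hd]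
    ext <;> simp [mul_assoc]

theorem isHomogeneous_of_mul_C_mul_X {σ : Type*} {d : MvPolynomial σ k} {c : k} (hc : c ≠ 0)
    {i : σ} {p : ℕ} (h : (d * (C c * X i)).IsHomogeneous (p + 1)) : d.IsHomogeneous p := by
  intro e he
  have := @h (e + Finsupp.single i 1) (by
    rw [mul_left_comm, coeff_C_mul, coeff_mul_X]
    exact mul_ne_zero hc he)
  rw [map_add, Finsupp.weight_single] at this
  simpa using this

/-- The forms of degree `p + 2` that are of degree at most one in `x₀, x₁`. -/
noncomputable def normalForm (k : Type*) [Field k] (N p : ℕ) :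
    (homogeneousSubmodule (Fin (N + 2)) k (p + 2) ×
      homogeneousSubmodule (Fin (N + 2)) k (p + 1) ×
      homogeneousSubmodule (Fin (N + 2)) k (p + 1)) →ₗ[k] MvPolynomial (Fin (N + 4)) k :=
  ((shiftTwo k N).toLinearMap ∘ₗ Submodule.subtype _).coprod
    ((LinearMap.mulLeft k (X 0) ∘ₗ (shiftTwo k N).toLinearMap ∘ₗ Submodule.subtype _).coprod
      (LinearMap.mulLeft k (X 1) ∘ₗ (shiftTwo k N).toLinearMap ∘ₗ Submodule.subtype _))

theorem normalForm_apply {p : ℕ} (v) : normalForm k N p v =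
    shiftTwo k N v.1 + (X 0 * shiftTwo k N v.2.1 + X 1 * shiftTwo k N v.2.2) := rfl

theorem firstOrder_normalForm {p : ℕ} (v) : firstOrder k N (normalForm k N p v) =
    TrivSqZeroExt.inl v.1.1 + TrivSqZeroExt.inr (v.2.1.1, v.2.2.1) := by
  rw [normalForm_apply]
  simp only [map_add, map_mul, firstOrder_shiftTwo, firstOrder_X_zero, firstOrder_X_one]
  ext <;> simp

theorem normalForm_isHomogeneous {p : ℕ} (v) : (normalForm k N p v).IsHomogeneous (p + 2) := by
  rw [normalForm_apply]
  have h1 : (X 0 * shiftTwo k N v.2.1).IsHomogeneous (1 + (p + 1)) :=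
    (isHomogeneous_X _ _).mul (IsHomogeneous.rename_isHomogeneous v.2.1.2)
  have h2 : (X 1 * shiftTwo k N v.2.2).IsHomogeneous (1 + (p + 1)) :=
    (isHomogeneous_X _ _).mul (IsHomogeneous.rename_isHomogeneous v.2.2.2)
  rw [show 1 + (p + 1) = p + 2 by ring] at h1 h2
  exact (IsHomogeneous.rename_isHomogeneous v.1.2).add (h1.add h2)

theorem monomial_eq_mul_shiftTwo (e : Fin (N + 4) →₀ ℕ) (c : k) :
    monomial e c = X 0 ^ e 0 * X 1 ^ e 1 * shiftTwo k N (monomial e.tail.tail c) := by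
  rw [shiftTwo, rename_monomial, X_pow_eq_monomial, X_pow_eq_monomial, monomial_mul, monomial_mul,
    one_mul, one_mul]
  refine congrArg (fun e => monomial e c) ?_
  have hinj : Function.Injective fun i : Fin (N + 2) => i.succ.succ :=
    (Fin.succ_injective _).comp (Fin.succ_injective _)
  have hone (i : Fin (N + 2)) : i.succ.succ ≠ (1 : Fin (N + 4)) :=
    fun h => Fin.succ_ne_zero i (Fin.succ_injective _ h)
  ext i
  rw [Finsupp.add_apply, Finsupp.add_apply]
  refine Fin.cases ?_ (fun i => Fin.cases ?_ (fun i => ?_) i) i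
  · rw [Finsupp.mapDomain_of_notMem_range _ _ (by simp)]
    simp
  · rw [Finsupp.mapDomain_of_notMem_range _ _ (by simpa using hone)]
    simp
  · rw [Finsupp.mapDomain_apply hinj, Finsupp.single_eq_of_ne (Fin.succ_ne_zero _),
      Finsupp.single_eq_of_ne (hone i), zero_add, zero_add]
    rfl

theorem degree_eq_add_degree_tail_tail (e : Fin (N + 4) →₀ ℕ) :
    e.degree = e 0 + e 1 + e.tail.tail.degree := by
  simp [Finsupp.degree_eq_sum, Fin.sum_univ_succ (n := N + 3), Fin.sum_univ_succ (n := N + 2),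
    Finsupp.tail_apply, add_assoc]

theorem monomial_mem_range_normalForm_sup {s t : k} {p : ℕ} {e : Fin (N + 4) →₀ ℕ}
    (he : e.degree = p + 2) (c : k) :
    monomial e c ∈ LinearMap.range (normalForm k N p) ⊔ (pencilIdeal N s t).restrictScalars k := by
  have hdeg := degree_eq_add_degree_tail_tail e
  have htail {q : ℕ} (h : e.tail.tail.degree = q) :
      monomial e.tail.tail c ∈ homogeneousSubmodule (Fin (N + 2)) k q :=
    isHomogeneous_monomial c h
  rw [monomial_eq_mul_shiftTwo]
  have hI {a b : MvPolynomial (Fin (N + 4)) k} (ha : a ∈ pencilIdeal N s t) :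
      a * b ∈ LinearMap.range (normalForm k N p) ⊔ (pencilIdeal N s t).restrictScalars k :=
    Submodule.mem_sup_right ((pencilIdeal N s t).mul_mem_right b ha)
  have hX0 : X 0 ^ 2 ∈ pencilIdeal N s t := Ideal.subset_span (by simp)
  have hX01 : X 0 * X 1 ∈ pencilIdeal N s t := Ideal.subset_span (by simp)
  have hX1 : X 1 ^ 2 ∈ pencilIdeal N s t := Ideal.subset_span (by simp)
  rcases h0 : e 0 with _ | _ | a <;> rcases h1 : e 1 with _ | _ | b
  · refine Submodule.mem_sup_left ⟨(⟨_, htail (by omega)⟩, 0, 0), ?_⟩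
    simp [normalForm_apply]
  · refine Submodule.mem_sup_left ⟨(0, 0, ⟨_, htail (by omega)⟩), ?_⟩
    simp [normalForm_apply]
  · refine hI (Ideal.mul_mem_left _ _ ((pencilIdeal N s t).pow_mem_of_pow_mem hX1 ?_))
    omega
  · refine Submodule.mem_sup_left ⟨(0, ⟨_, htail (by omega)⟩, 0), ?_⟩
    simp [normalForm_apply]
  · refine hI ?_
    simpa using hX01
  · refine hI (Ideal.mul_mem_left _ _ ((pencilIdeal N s t).pow_mem_of_pow_mem hX1 ?_))
    omega
  all_goals
    refine hI (Ideal.mul_mem_right _ _ ((pencilIdeal N s t).pow_mem_of_pow_mem hX0 ?_))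
    omega

theorem range_mk_comp_normalForm (s t : k) (p : ℕ) :
    LinearMap.range ((Ideal.Quotient.mkₐ k (pencilIdeal N s t)).toLinearMap ∘ₗ normalForm k N p) =
      (homogeneousSubmodule (Fin (N + 4)) k (p + 2)).map
        (Ideal.Quotient.mkₐ k (pencilIdeal N s t)).toLinearMap := by
  apply le_antisymm
  · rintro _ ⟨v, rfl⟩
    exact ⟨_, normalForm_isHomogeneous v, rfl⟩
  · rintro _ ⟨f, hf, rfl⟩
    have hmem : f ∈ LinearMap.range (normalForm k N p) ⊔
        (pencilIdeal N s t).restrictScalars k := by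
      rw [f.as_sum]
      refine Submodule.sum_mem _ fun e he => monomial_mem_range_normalForm_sup ?_ _
      rw [Finsupp.degree_eq_weight_one]
      exact hf (mem_support_iff.mp he)
    obtain ⟨_, ⟨v, rfl⟩, b, hb, rfl⟩ := Submodule.mem_sup.mp hmem
    refine ⟨v, ?_⟩
    simpa using (Ideal.Quotient.eq_zero_iff_mem.mpr hb)

/-- Multiplication by the linear form `c·xᵢ`. -/
noncomputable def mulLinear {σ : Type*} (c : k) (i : σ) (p : ℕ) :
    homogeneousSubmodule σ k p →ₗ[k] homogeneousSubmodule σ k (p + 1) :=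
  (LinearMap.mulRight k (C c * X i)).restrict fun _ hd =>
    IsHomogeneous.mul hd (isHomogeneous_C_mul_X _ _)

/-- The relations between normal forms modulo the pencil ideal: multiples of `(0, t·x₃, -s·x₂)`. -/
noncomputable def relation (N : ℕ) (s t : k) (p : ℕ) :
    homogeneousSubmodule (Fin (N + 2)) k p →ₗ[k]
      (homogeneousSubmodule (Fin (N + 2)) k (p + 2) ×
        homogeneousSubmodule (Fin (N + 2)) k (p + 1) ×
        homogeneousSubmodule (Fin (N + 2)) k (p + 1)) :=
  LinearMap.prod 0 ((mulLinear t 1 p).prod (-mulLinear s 0 p))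

theorem relation_apply (s t : k) {p : ℕ} (d) : relation N s t p d =
    (0, mulLinear t 1 p d, -mulLinear s 0 p d) := rfl

theorem coe_mulLinear {σ : Type*} (c : k) (i : σ) {p : ℕ} (d) :
    (mulLinear c i p d : MvPolynomial σ k) = d.1 * (C c * X i) := rfl

theorem relation_injective {s t : k} (hst : (s, t) ≠ (0, 0)) (p : ℕ) :
    Function.Injective (relation N s t p) := by
  rw [injective_iff_map_eq_zero]
  intro d hd
  have h1 : d.1 * (C t * X 1) = 0 := congrArg (fun v => v.2.1.1) hd
  have h2 : -(d.1 * (C s * X 0)) = 0 := congrArg (fun v => v.2.2.1) hd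
  by_contra hne
  have hne : d.1 ≠ 0 := fun h => hne (Subtype.ext h)
  simp_all

theorem ker_mk_comp_normalForm {s t : k} (hst : (s, t) ≠ (0, 0)) (p : ℕ) :
    LinearMap.ker ((Ideal.Quotient.mkₐ k (pencilIdeal N s t)).toLinearMap ∘ₗ normalForm k N p) =
      LinearMap.range (relation N s t p) := by
  ext v
  have hker : v ∈ LinearMap.ker ((Ideal.Quotient.mkₐ k (pencilIdeal N s t)).toLinearMap ∘ₗ
      normalForm k N p) ↔ normalForm k N p v ∈ pencilIdeal N s t :=
    Ideal.Quotient.eq_zero_iff_mem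
  rw [hker]
  constructor
  · intro hv
    obtain ⟨d, hd⟩ := firstOrder_mem_of_mem_pencilIdeal hv
    rw [firstOrder_normalForm] at hd
    have h0 : v.1.1 = 0 := by simpa using congrArg TrivSqZeroExt.fst hd
    have h12 : (v.2.1.1, v.2.2.1) = (d * (C t * X 1), -(d * (C s * X 0))) := by
      simpa using congrArg TrivSqZeroExt.snd hd
    obtain ⟨h1, h2⟩ := Prod.mk.inj h12
    have hdhom : d.IsHomogeneous p := by
      by_cases ht : t = 0
      · have hs : s ≠ 0 := by rintro rfl; exact hst (by rw [ht])
        apply isHomogeneous_of_mul_C_mul_X hs (i := 0)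
        rw [← neg_neg (d * _), ← h2]
        exact IsHomogeneous.neg v.2.2.2
      · apply isHomogeneous_of_mul_C_mul_X ht (i := 1)
        rw [← h1]
        exact v.2.1.2
    exact ⟨⟨d, hdhom⟩, Prod.ext (Subtype.ext h0.symm)
      (Prod.ext (Subtype.ext h1.symm) (Subtype.ext h2.symm))⟩
  · rintro ⟨d, rfl⟩
    have : normalForm k N p (relation N s t p d) =
        shiftTwo k N d * (C t * (X 0 * X 3) - C s * (X 1 * X 2)) := by
      have h2 : shiftTwo k N (X 0) = X 2 := rename_X _ _
      have h3 : shiftTwo k N (X 1) = X 3 := rename_X _ _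
      have hC (c : k) : shiftTwo k N (C c) = C c := rename_C _ _
      simp only [normalForm_apply, relation_apply, coe_mulLinear, map_mul, map_neg,
        NegMemClass.coe_neg, ZeroMemClass.coe_zero, map_zero, h2, h3, hC]
      ring
    rw [this]
    exact Ideal.mul_mem_left _ _ (Ideal.subset_span (by simp))

theorem finrank_map_mk_pencilIdeal {s t : k} (hst : (s, t) ≠ (0, 0)) (p : ℕ) :
    Module.finrank k ((homogeneousSubmodule (Fin (N + 4)) k (p + 2)).map
        (Ideal.Quotient.mkₐ k (pencilIdeal N s t)).toLinearMap) =
      2 * Module.finrank k (homogeneousSubmodule (Fin (N + 2)) k (p + 2)) -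
        Module.finrank k (homogeneousSubmodule (Fin N) k (p + 2)) := by
  have hfin (q : ℕ) : Module.Finite k (homogeneousSubmodule (Fin (N + 2)) k q) :=
    Module.Finite.iff_fg.mpr (homogeneousSubmodule_fg _ _ q)
  have h := LinearMap.finrank_range_add_finrank_ker
    ((Ideal.Quotient.mkₐ k (pencilIdeal N s t)).toLinearMap ∘ₗ normalForm k N p)
  rw [range_mk_comp_normalForm, ker_mk_comp_normalForm hst,
    LinearMap.finrank_range_of_inj (relation_injective hst p), Module.finrank_prod,
    Module.finrank_prod] at h
  simp only [finrank_homogeneousSubmodule_fin] at h ⊢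
  have := multichoose_second_difference N p
  omega

end

/-- for `[s,t] ∈ ℙ¹` (i.e. `(s,t) ≠ (0,0)`), the ideal
`I_{s,t} = (x₀², x₀x₁, x₁², t·x₀x₃ - s·x₁x₂) ⊂ k[x₀,…,xₙ]`, `n ≥ 3`, has Hilbert
polynomial `Pₙ(m) = 2C(n-2+m,m) - C(n-4+m,m)`: for all large `m`, `dim_k (S/I_{s,t})_m`
equals `Pₙ(m)` (encoded as twice the dimension of the degree-`m` piece of a polynomial
ring in `n-1` variables minus that of one in `n-3` variables, the correct reading also
for `n = 3`). -/
theorem stmt_15 (k : Type*) [Field k] (n : ℕ) (hn : 3 ≤ n)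
    (s t : k) (hst : (s, t) ≠ (0, 0))
    (I : Ideal (MvPolynomial (Fin (n + 1)) k))
    (hI : I = Ideal.span {X (⟨0, by omega⟩ : Fin (n + 1)) ^ 2,
        X (⟨0, by omega⟩ : Fin (n + 1)) * X ⟨1, by omega⟩,
        X (⟨1, by omega⟩ : Fin (n + 1)) ^ 2,
        C t * (X (⟨0, by omega⟩ : Fin (n + 1)) * X ⟨3, by omega⟩)
          - C s * (X (⟨1, by omega⟩ : Fin (n + 1)) * X ⟨2, by omega⟩)}) :
    ∃ M : ℕ, ∀ m ≥ M,
      Module.finrank k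
        ((homogeneousSubmodule (Fin (n + 1)) k m).map
          (Ideal.Quotient.mkₐ k I).toLinearMap)
      = 2 * Module.finrank k (homogeneousSubmodule (Fin (n - 1)) k m)
          - Module.finrank k (homogeneousSubmodule (Fin (n - 3)) k m) := by
  subst hI
  obtain ⟨N, rfl⟩ : ∃ N, n = N + 3 := ⟨n - 3, by omega⟩
  refine ⟨2, fun m hm => ?_⟩
  obtain ⟨p, rfl⟩ : ∃ p, m = p + 2 := ⟨m - 2, by omega⟩
  exact finrank_map_mk_pencilIdeal (N := N) hst p
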